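/- Fix a natural number n ≥ 3 and a real α with 0 < α < 1/2. For θ = (μ, v₁, v₂) ∈ ℝ × (0,∞) × (0,∞), let P_θ = (gaussianReal μ v₁)^{⊗n} ⊗ (gaussianReal μ v₂)^{⊗n} on (Fin n → ℝ) × (Fin n → ℝ); for a sample x = (x₁, x₂) let X̄ᵢ(x) = (1/n) ∑ⱼ xᵢ(j) and Sᵢ²(x) = (1/(n−1)) ∑ⱼ (xᵢ(j) − X̄ᵢ(x))²; for measurable φ : ℝ × ℝ → [0,1] let δ_φ(x) = X̄₁(x) + (X̄₂(x) − X̄₁(x)) · φ(S₁²(x), S₂²(x)) and R(θ, φ) = ∫ (δ_φ(x) − μ)² dP_θ(x). For β > 0 let Π_{α,β} be the measure on (0,∞)² with density (v₁, v₂) ↦ ∏_{i=1,2} (β^α / Γ(α)) vᵢ^{−(α+1)} exp(−β/vᵢ) with respect to Lebesgue measure, and let Φ_β(s₁, s₂) = (s₁ + 2β/(n−1)) / (s₁ + s₂ + 4β/(n−1)). Then for every β > 0 and every measurable φ : ℝ × ℝ → [0,1], if the function (v₁, v₂) ↦ R((0, v₁, v₂), φ) − R((0, v₁, v₂), Φ_β)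 is Π_{α,β}-integrable, then ∫ (R((0, v₁, v₂), φ) − R((0, v₁, v₂), Φ_β)) dΠ_{α,β}(v₁, v₂) ≥ 0. -/

import Mathlib

open MeasureTheory ProbabilityTheory

/-- The joint law of two independent samples of size `n` from `N(μ, v₁)` and `N(μ, v₂)`. -/
noncomputable def sampleLaw (n : ℕ) (μ : ℝ) (v₁ v₂ : ℝ) :
    Measure ((Fin n → ℝ) × (Fin n → ℝ)) :=
  (Measure.pi fun _ : Fin n => gaussianReal μ v₁.toNNReal).prod
    (Measure.pi fun _ : Fin n => gaussianReal μ v₂.toNNReal)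

/-- The sample mean of `n` observations. -/
noncomputable def sampleMean (n : ℕ) (x : Fin n → ℝ) : ℝ := (∑ j, x j) / n

/-- The (Bessel-corrected) sample variance of `n` observations. -/
noncomputable def sampleVar (n : ℕ) (x : Fin n → ℝ) : ℝ :=
  (∑ j, (x j - sampleMean n x) ^ 2) / (n - 1)

/-- The estimator `X̄₁ + (X̄₂ - X̄₁) · φ(S₁², S₂²)` of the common mean. -/
noncomputable def estimatorOf (n : ℕ) (φ : ℝ × ℝ → ℝ)
    (x : (Fin n → ℝ) × (Fin n → ℝ)) : ℝ :=
  sampleMean n x.1 + (sampleMean n x.2 - sampleMean n x.1) *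
    φ (sampleVar n x.1, sampleVar n x.2)

/-- The squared-error risk of the estimator determined by `φ` at `θ = (μ, v₁, v₂)`. -/
noncomputable def risk (n : ℕ) (μ v₁ v₂ : ℝ) (φ : ℝ × ℝ → ℝ) : ℝ :=
  ∫ x, (estimatorOf n φ x - μ) ^ 2 ∂(sampleLaw n μ v₁ v₂)

/-- The Graybill–Deal weight function `s₁ / (s₁ + s₂)`. -/
noncomputable def gdWeight (s : ℝ × ℝ) : ℝ := s.1 / (s.1 + s.2)


/-- The inverse-gamma(α, β) density on `(0,∞)`, extended by `0` elsewhere. -/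
noncomputable def invGammaDensity (α β v : ℝ) : ℝ :=
  if 0 < v then β ^ α / Real.Gamma α * v ^ (-(α + 1)) * Real.exp (-β / v) else 0

/-- The product of two inverse-gamma(α, β) distributions, as a measure on `ℝ × ℝ`
with density with respect to two-dimensional Lebesgue measure. -/
noncomputable def invGammaPrior (α β : ℝ) : Measure (ℝ × ℝ) :=
  (volume : Measure (ℝ × ℝ)).withDensity fun v =>
    ENNReal.ofReal (invGammaDensity α β v.1 * invGammaDensity α β v.2)

/-- The Bayes weight function `Φ_β(s₁,s₂) = (s₁ + 2β/(n-1))/(s₁ + s₂ + 4β/(n-1))`. -/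
noncomputable def bayesWeight (n : ℕ) (β : ℝ) (s : ℝ × ℝ) : ℝ :=
  (s.1 + 2 * β / (n - 1)) / (s.1 + s.2 + 4 * β / (n - 1))


noncomputable section

abbrev gpi (n : ℕ) (v : ℝ) : Measure (Fin n → ℝ) :=
  Measure.pi fun _ : Fin n => gaussianReal 0 v.toNNReal

lemma gpi_hasGaussianLaw_id (n : ℕ) (v : ℝ) :
    HasGaussianLaw (fun (x : Fin n → ℝ) i => x i) (gpi n v) := by
  refine iIndepFun.hasGaussianLaw (X := fun i (x : Fin n → ℝ) => x i) (fun i => ?_) ?_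
  · have : IsGaussian ((gpi n v).map (fun x => x i)) := by
      rw [(measurePreserving_eval _ i).map_eq]
      infer_instance
    exact IsGaussian.hasGaussianLaw
  · exact iIndepFun_pi (X := fun _ x => x) (fun i => aemeasurable_id)

lemma gpi_cov (n : ℕ) (v : ℝ) (i j : Fin n) :
    cov[fun x : Fin n → ℝ => x i, fun x => x j; gpi n v] = if i = j then (v.toNNReal : ℝ) else 0 := by
  have hid := gpi_hasGaussianLaw_id n v
  split_ifs with h
  · subst h
    rw [covariance_self (measurable_pi_apply i).aemeasurable]
    have := (variance_map (X := fun x : ℝ => x) (Y := fun x : Fin n → ℝ => x i) (μ := gpi n v)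
      (by fun_prop) (measurable_pi_apply i).aemeasurable)
    rw [(measurePreserving_eval _ i).map_eq, variance_fun_id_gaussianReal] at this
    rw [this]; rfl
  · exact IndepFun.covariance_eq_zero
      ((iIndepFun_pi (μ := fun _ : Fin n => gaussianReal 0 v.toNNReal)
        (X := fun _ x => x) (fun i => aemeasurable_id)).indepFun h)
      (hid.eval i).memLp_two (hid.eval j).memLp_two

lemma measurable_sampleMean (n : ℕ) : Measurable (sampleMean n) := by
  unfold sampleMean; fun_prop

lemma measurable_sampleVar (n : ℕ) : Measurable (sampleVar n) := by
  have := measurable_sampleMean n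
  unfold sampleVar; fun_prop

def meanL (n : ℕ) : (Fin n → ℝ) →L[ℝ] ℝ :=
  (n : ℝ)⁻¹ • ∑ j, ContinuousLinearMap.proj j

lemma meanL_apply (n : ℕ) (x : Fin n → ℝ) : meanL n x = sampleMean n x := by
  simp [meanL, sampleMean, div_eq_inv_mul]

lemma gpi_memLp (n : ℕ) (v : ℝ) (i : Fin n) : MemLp (fun x : Fin n → ℝ => x i) 2 (gpi n v) :=
  ((gpi_hasGaussianLaw_id n v).eval i).memLp_two

lemma mean_hasGaussianLaw (n : ℕ) (v : ℝ) : HasGaussianLaw (sampleMean n) (gpi n v) := by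
  have := (gpi_hasGaussianLaw_id n v).map_fun (meanL n)
  simpa only [meanL_apply] using this

lemma cov_mean_coord (n : ℕ) (v : ℝ) (i : Fin n) :
    cov[sampleMean n, fun x => x i; gpi n v] = (v.toNNReal : ℝ) / n := by
  unfold sampleMean
  rw [covariance_fun_div_left, covariance_fun_sum_left (fun j => gpi_memLp n v j) (gpi_memLp n v i)]
  simp [gpi_cov]

lemma cov_mean_mean (n : ℕ) (hn : 3 ≤ n) (v : ℝ) :
    cov[sampleMean n, sampleMean n; gpi n v] = (v.toNNReal : ℝ) / n := by
  have h : cov[sampleMean n, fun x => (∑ j, x j) / n; gpi n v] = (v.toNNReal : ℝ) / n := by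
    rw [covariance_fun_div_right, covariance_fun_sum_right (fun j => gpi_memLp n v j)
      (mean_hasGaussianLaw n v).memLp_two]
    simp [cov_mean_coord n]
    have : (n : ℝ) ≠ 0 := by positivity
    field_simp
  exact h

lemma indep_mean_var (n : ℕ) (hn : 3 ≤ n) (v : ℝ) :
    IndepFun (sampleMean n) (sampleVar n) (gpi n v) := by
  have h : IndepFun (fun (x : Fin n → ℝ) (_ : Fin 1) => sampleMean n x)
      (fun (x : Fin n → ℝ) (j : Fin n) => x j - sampleMean n x) (gpi n v) := by
    refine HasGaussianLaw.indepFun_of_covariance_eval (X := fun _ => sampleMean n)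
      (Y := fun j x => x j - sampleMean n x) ?_ ?_
    · have := (gpi_hasGaussianLaw_id n v).map_fun
        ((ContinuousLinearMap.pi fun _ : Fin 1 => meanL n).prod
          (ContinuousLinearMap.pi fun j => ContinuousLinearMap.proj j - meanL n))
      have e : (fun x : Fin n → ℝ => ((ContinuousLinearMap.pi fun _ : Fin 1 => meanL n).prod
          (ContinuousLinearMap.pi fun j => ContinuousLinearMap.proj j - meanL n)) fun i => x i)
          = fun x : Fin n → ℝ => ((fun _ : Fin 1 => sampleMean n x),
            (fun j => x j - sampleMean n x)) := by
        funext x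
        refine Prod.ext ?_ ?_
        · funext j
          simp [meanL_apply]
        · funext j
          simp [meanL_apply]
      rw [e] at this
      exact this
    · intro i j
      rw [covariance_fun_sub_right (mean_hasGaussianLaw n v).memLp_two (gpi_memLp n v j)
        (mean_hasGaussianLaw n v).memLp_two, cov_mean_coord n, cov_mean_mean n hn, sub_self]
  have hm0 : Measurable (fun f : Fin 1 → ℝ => f 0) := measurable_pi_apply 0
  have h2 := h.comp (φ := fun f : Fin 1 → ℝ => f 0)
    (ψ := fun f : Fin n → ℝ => (∑ j, (f j)^2) / ((n : ℝ) - 1)) hm0 (by fun_prop)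
  exact h2

lemma integral_mean (n : ℕ) (v : ℝ) : ∫ x, sampleMean n x ∂(gpi n v) = 0 := by
  unfold sampleMean
  rw [integral_div, integral_finsetSum _ (fun i _ => (gpi_memLp n v i).integrable (by norm_num))]
  have : ∀ i : Fin n, ∫ x : Fin n → ℝ, x i ∂(gpi n v) = 0 := by
    intro i
    have h := integral_map (μ := gpi n v) (φ := fun x : Fin n → ℝ => x i)
      (measurable_pi_apply i).aemeasurable
      (f := fun x : ℝ => x) (by fun_prop)
    rw [(measurePreserving_eval _ i).map_eq, integral_id_gaussianReal] at h
    exact h.symm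
  simp [this]

lemma map_mean (n : ℕ) (hn : 3 ≤ n) (v : ℝ) (hv : 0 < v) :
    (gpi n v).map (sampleMean n) = gaussianReal 0 (v / n).toNNReal := by
  have h := (mean_hasGaussianLaw n v).map_eq_gaussianReal
  rw [← covariance_self (measurable_sampleMean n).aemeasurable, cov_mean_mean n hn,
    integral_mean] at h
  rw [h, Real.coe_toNNReal _ hv.le]

lemma integral_mean_sq (n : ℕ) (hn : 3 ≤ n) (v : ℝ) (hv : 0 < v) :
    ∫ x, sampleMean n x ^ 2 ∂(gpi n v) = v / n := by
  have h := cov_mean_mean n hn v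
  rw [covariance_eq_sub (mean_hasGaussianLaw n v).memLp_two (mean_hasGaussianLaw n v).memLp_two,
    integral_mean, Real.coe_toNNReal _ hv.le] at h
  simpa [pow_two] using h

lemma pi_withDensity_aux (n : ℕ) (μ : Measure ℝ) [IsProbabilityMeasure μ] (f : ℝ → ENNReal)
    (hf : Measurable f) [IsProbabilityMeasure (μ.withDensity f)] :
    Measure.pi (fun _ : Fin n => μ.withDensity f) =
      (Measure.pi (fun _ : Fin n => μ)).withDensity (fun x => ∏ i, f (x i)) := by
  refine Measure.pi_eq (fun s hs => ?_)
  rw [withDensity_apply _ (MeasurableSet.univ_pi hs), ← lintegral_indicator (MeasurableSet.univ_pi hs)]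
  have h1 : ∀ x : Fin n → ℝ, (Set.univ.pi s).indicator (fun x => ∏ i, f (x i)) x
      = ∏ i, (s i).indicator f (x i) := by
    intro x
    by_cases hx : x ∈ Set.univ.pi s
    · rw [Set.indicator_of_mem hx]
      exact Finset.prod_congr rfl fun i _ => (Set.indicator_of_mem (hx i trivial) _).symm
    · rw [Set.indicator_of_notMem hx]
      simp only [Set.mem_pi, Set.mem_univ, true_imp_iff, not_forall] at hx
      obtain ⟨i, hi⟩ := hx
      exact (Finset.prod_eq_zero (Finset.mem_univ i) (Set.indicator_of_notMem hi _)).symm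
  simp_rw [h1]
  have hm : ∀ i, Measurable ((s i).indicator f) := fun i => hf.indicator (hs i)
  rw [lintegral_prod_eq_prod_lintegral_of_indepFun Finset.univ
    (fun i (x : Fin n → ℝ) => (s i).indicator f (x i))
    (iIndepFun_pi (X := fun i => (s i).indicator f) (fun i => (hm i).aemeasurable))
    (fun i => (hm i).comp (measurable_pi_apply i))]
  refine Finset.prod_congr rfl fun i _ => ?_
  rw [withDensity_apply _ (hs i), ← lintegral_indicator (hs i)]
  have := lintegral_map (μ := Measure.pi (fun _ : Fin n => μ)) (hm i) (measurable_pi_apply i)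
  rw [(measurePreserving_eval _ i).map_eq] at this
  exact this.symm

/-- Gaussian density ratio `N(0, v c) / N(0, c)`. -/
def gr (c v x : ℝ) : ℝ := (√v)⁻¹ * Real.exp (x ^ 2 / (2 * c) * (1 - 1 / v))

lemma gr_nonneg (c v x : ℝ) : 0 ≤ gr c v x := by unfold gr; positivity

lemma measurable_gr (c v : ℝ) : Measurable (gr c v) := by unfold gr; fun_prop

lemma gaussian_ratio (c v : ℝ) (hc : 0 < c) (hv : 0 < v) :
    gaussianReal 0 (v * c).toNNReal =
      (gaussianReal 0 c.toNNReal).withDensity (fun x => ENNReal.ofReal (gr c v x)) := by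
  have h1 : c.toNNReal ≠ 0 := by simpa using hc
  have h2 : (v * c).toNNReal ≠ 0 := by simpa using mul_pos hv hc
  rw [gaussianReal_of_var_ne_zero _ h1, gaussianReal_of_var_ne_zero _ h2,
    ← withDensity_mul _ (measurable_gaussianPDF _ _) (measurable_gr c v).ennreal_ofReal]
  congr 1
  funext x
  rw [Pi.mul_apply, gaussianPDF, gaussianPDF, ← ENNReal.ofReal_mul (gaussianPDFReal_nonneg _ _ _)]
  congr 1
  rw [gaussianPDFReal, gaussianPDFReal, gr, Real.coe_toNNReal _ hc.le,
    Real.coe_toNNReal _ (mul_pos hv hc).le, show 2 * Real.pi * (v * c) = (2 * Real.pi * c) * v by ring,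
    Real.sqrt_mul (by positivity), mul_inv]
  rw [show ∀ a b c d : ℝ, a * b * (c * d) = a * c * (b * d) by intros; ring, ← Real.exp_add]
  congr 2
  field_simp
  ring

/-- The density ratio of the sample variance. -/
def kap (n : ℕ) (v s : ℝ) : ℝ :=
  (√v)⁻¹ ^ (n - 1) * Real.exp (((n : ℝ) - 1) * s / 2 * (1 - 1 / v))

lemma kap_nonneg (n : ℕ) (v s : ℝ) : 0 ≤ kap n v s := by unfold kap; positivity

lemma measurable_kap (n : ℕ) (v : ℝ) : Measurable (kap n v) := by unfold kap; fun_prop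

lemma sum_sq_decomp (n : ℕ) (hn : 3 ≤ n) (x : Fin n → ℝ) :
    ∑ i, x i ^ 2 = ((n : ℝ) - 1) * sampleVar n x + n * sampleMean n x ^ 2 := by
  have h1 : (n : ℝ) - 1 ≠ 0 := by
    have : (3 : ℝ) ≤ n := by exact_mod_cast hn
    linarith
  have h0 : (n : ℝ) ≠ 0 := by positivity
  have hs : ∑ i, x i = n * sampleMean n x := by unfold sampleMean; field_simp
  unfold sampleVar
  rw [mul_div_cancel₀ _ h1]
  simp_rw [sub_sq, Finset.sum_add_distrib, Finset.sum_sub_distrib, ← Finset.sum_mul,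
    ← Finset.mul_sum, hs]
  simp
  ring

lemma prod_gr (n : ℕ) (hn : 3 ≤ n) (v : ℝ) (x : Fin n → ℝ) :
    ∏ i, gr 1 v (x i) = gr (1 / n) v (sampleMean n x) * kap n v (sampleVar n x) := by
  unfold gr kap
  rw [Finset.prod_mul_distrib, ← Real.exp_sum, ← Finset.sum_mul, ← Finset.sum_div,
    sum_sq_decomp n hn]
  simp only [Finset.prod_const, Finset.card_univ, Fintype.card_fin]
  rw [show ∀ a b c d : ℝ, a * b * (c * d) = a * c * (b * d) by intros; ring, ← Real.exp_add,
    ← pow_succ', Nat.sub_add_cancel (by omega)]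
  have h0 : (n : ℝ) ≠ 0 := by positivity
  congr 2
  field_simp
  ring

/-- law of the sample variance -/
def mS (n : ℕ) (v : ℝ) : Measure ℝ := (gpi n v).map (sampleVar n)

instance (n : ℕ) (v : ℝ) : IsProbabilityMeasure (mS n v) :=
  Measure.isProbabilityMeasure_map (measurable_sampleVar n).aemeasurable

lemma mS_eq (n : ℕ) (hn : 3 ≤ n) (v : ℝ) (hv : 0 < v) :
    mS n v = (mS n 1).withDensity (fun s => ENNReal.ofReal (kap n v s)) := by
  have hr := gaussian_ratio 1 v one_pos hv
  rw [mul_one] at hr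
  have hp : IsProbabilityMeasure ((gaussianReal 0 (1 : ℝ).toNNReal).withDensity
      (fun x => ENNReal.ofReal (gr 1 v x))) := by rw [← hr]; infer_instance
  have hg : gpi n v = (gpi n 1).withDensity (fun x => ENNReal.ofReal
      (gr (1 / n) v (sampleMean n x) * kap n v (sampleVar n x))) := by
    have := pi_withDensity_aux n (gaussianReal 0 (1 : ℝ).toNNReal) _ (measurable_gr 1 v).ennreal_ofReal
    rw [← hr] at this
    rw [gpi, this]
    congr 1
    funext x
    rw [← prod_gr n hn, ENNReal.ofReal_prod_of_nonneg (fun i _ => gr_nonneg _ _ _)]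
  have hmv := measurable_sampleVar n
  have hmm := measurable_sampleMean n
  have hone : ∫⁻ x, ENNReal.ofReal (gr (1 / n) v (sampleMean n x)) ∂(gpi n 1) = 1 := by
    rw [← lintegral_map (f := fun y => ENNReal.ofReal (gr (1 / n) v y))
      (measurable_gr _ v).ennreal_ofReal hmm, map_mean n hn 1 one_pos]
    have h2 := gaussian_ratio (1 / n) v (by positivity) hv
    have h3 : gaussianReal 0 (v * (1 / n)).toNNReal Set.univ = 1 := measure_univ
    rw [h2, withDensity_apply _ MeasurableSet.univ, Measure.restrict_univ] at h3
    exact h3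
  ext A hA
  have hmk : Measurable (A.indicator fun s => ENNReal.ofReal (kap n v s)) :=
    (measurable_kap n v).ennreal_ofReal.indicator hA
  rw [withDensity_apply _ hA, ← lintegral_indicator hA, mS, mS, lintegral_map hmk hmv,
    Measure.map_apply hmv hA, hg, withDensity_apply _ (hmv hA), ← lintegral_indicator (hmv hA)]
  have hI := indep_mean_var n hn 1
  have := lintegral_mul_eq_lintegral_mul_lintegral_of_indepFun''
    (f := fun x => ENNReal.ofReal (gr (1 / n) v (sampleMean n x)))
    (g := fun x => A.indicator (fun s => ENNReal.ofReal (kap n v s)) (sampleVar n x))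
    ((measurable_gr _ v).ennreal_ofReal.comp hmm).aemeasurable (hmk.comp hmv).aemeasurable
    (hI.comp (measurable_gr _ v).ennreal_ofReal hmk)
  rw [hone, one_mul] at this
  rw [← this]
  refine lintegral_congr fun x => ?_
  by_cases hx : sampleVar n x ∈ A
  · rw [Set.indicator_of_mem hx, Set.indicator_of_mem (show x ∈ sampleVar n ⁻¹' A from hx),
      ENNReal.ofReal_mul (gr_nonneg _ _ _)]
  · rw [Set.indicator_of_notMem hx, Set.indicator_of_notMem (show x ∉ sampleVar n ⁻¹' A from hx),
      mul_zero]

lemma sampleVar_nonneg (n : ℕ) (hn : 3 ≤ n) (x : Fin n → ℝ) : 0 ≤ sampleVar n x := by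
  have : (3 : ℝ) ≤ n := by exact_mod_cast hn
  exact div_nonneg (Finset.sum_nonneg fun i _ => sq_nonneg _) (by linarith)

lemma integrable_fgpsi (n : ℕ) (v₁ v₂ : ℝ) (f g : ℝ → ℝ) (ψ : ℝ × ℝ → ℝ)
    (hψ : Measurable ψ) (C : ℝ)
    (hb : ∀ x y, |ψ (sampleVar n x, sampleVar n y)| ≤ C)
    (hfi : Integrable (fun x => f (sampleMean n x)) (gpi n v₁))
    (hgi : Integrable (fun x => g (sampleMean n x)) (gpi n v₂)) :
    Integrable (fun x : (Fin n → ℝ) × (Fin n → ℝ) => f (sampleMean n x.1) * g (sampleMean n x.2) *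
      ψ (sampleVar n x.1, sampleVar n x.2)) ((gpi n v₁).prod (gpi n v₂)) := by
  have hmv := measurable_sampleVar n
  refine Integrable.mul_bdd (c := C) (hfi.mul_prod hgi) ?_ ?_
  · exact (hψ.comp (by fun_prop : Measurable fun x : (Fin n → ℝ) × (Fin n → ℝ) =>
      (sampleVar n x.1, sampleVar n x.2))).aestronglyMeasurable
  · exact Filter.Eventually.of_forall fun x => hb _ _

lemma integral_fgpsi (n : ℕ) (hn : 3 ≤ n) (v₁ v₂ : ℝ) (f g : ℝ → ℝ) (ψ : ℝ × ℝ → ℝ)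
    (hf : Measurable f) (hg : Measurable g) (hψ : Measurable ψ) (C : ℝ)
    (hb : ∀ x y, |ψ (sampleVar n x, sampleVar n y)| ≤ C)
    (hfi : Integrable (fun x => f (sampleMean n x)) (gpi n v₁))
    (hgi : Integrable (fun x => g (sampleMean n x)) (gpi n v₂)) :
    ∫ x, f (sampleMean n x.1) * g (sampleMean n x.2) *
      ψ (sampleVar n x.1, sampleVar n x.2) ∂((gpi n v₁).prod (gpi n v₂)) =
    (∫ x, f (sampleMean n x) ∂(gpi n v₁)) * (∫ x, g (sampleMean n x) ∂(gpi n v₂)) *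
      ∫ s, ψ s ∂((mS n v₁).prod (mS n v₂)) := by
  have hmv := measurable_sampleVar n
  have hmm := measurable_sampleMean n
  have hΨ : ∫ s, ψ s ∂((mS n v₁).prod (mS n v₂)) =
      ∫ x, (∫ y, ψ (sampleVar n x, sampleVar n y) ∂(gpi n v₂)) ∂(gpi n v₁) := by
    rw [mS, mS, Measure.map_prod_map _ _ hmv hmv, integral_map (by fun_prop)
      hψ.aestronglyMeasurable, integral_prod]
    · rfl
    · refine Integrable.of_bound (C := C) (hψ.comp (by fun_prop)).aestronglyMeasurable ?_
      exact Filter.Eventually.of_forall fun x => hb _ _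
  rw [integral_prod _ (integrable_fgpsi n v₁ v₂ f g ψ hψ C hb hfi hgi), hΨ]
  have hin : ∀ x : Fin n → ℝ, ∫ y, f (sampleMean n x) * g (sampleMean n y) *
      ψ (sampleVar n x, sampleVar n y) ∂(gpi n v₂) =
      f (sampleMean n x) * (∫ y, ψ (sampleVar n x, sampleVar n y) ∂(gpi n v₂)) *
        (∫ y, g (sampleMean n y) ∂(gpi n v₂)) := by
    intro x
    have hI : IndepFun (fun y => g (sampleMean n y)) (fun y => ψ (sampleVar n x, sampleVar n y))
      (gpi n v₂) := (indep_mean_var n hn v₂).comp hg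
        (hψ.comp (measurable_const.prodMk measurable_id) : Measurable fun s => ψ (sampleVar n x, s))
    have h := hI.integral_fun_mul_eq_mul_integral (hg.comp hmm).aestronglyMeasurable
      (hψ.comp (measurable_const.prodMk hmv)).aestronglyMeasurable
    simp_rw [mul_assoc, integral_const_mul]
    rw [h]
    ring
  simp_rw [hin]
  rw [integral_mul_const]
  have hmΨ : Measurable fun s => ∫ y, ψ (s, sampleVar n y) ∂(gpi n v₂) := by
    have : StronglyMeasurable (fun p : ℝ × (Fin n → ℝ) => ψ (p.1, sampleVar n p.2)) :=
      (hψ.comp (by fun_prop : Measurable fun p : ℝ × (Fin n → ℝ) =>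
        (p.1, sampleVar n p.2))).stronglyMeasurable
    exact (this.integral_prod_right').measurable
  have hI : IndepFun (fun y => f (sampleMean n y))
      (fun x => ∫ y, ψ (sampleVar n x, sampleVar n y) ∂(gpi n v₂)) (gpi n v₁) :=
    (indep_mean_var n hn v₁).comp hf hmΨ
  have h := hI.integral_fun_mul_eq_mul_integral (hf.comp hmm).aestronglyMeasurable
      (hmΨ.comp hmv).aestronglyMeasurable
  rw [h]
  ring

lemma risk_eq (n : ℕ) (hn : 3 ≤ n) (v₁ v₂ : ℝ) (h₁ : 0 < v₁) (h₂ : 0 < v₂) (φ : ℝ × ℝ → ℝ)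
    (hφ : Measurable φ) (hb : ∀ s : ℝ × ℝ, 0 ≤ s.1 → 0 ≤ s.2 → φ s ∈ Set.Icc (0 : ℝ) 1) :
    risk n 0 v₁ v₂ φ =
      v₁ / n * (∫ s, (1 - φ s) ^ 2 ∂((mS n v₁).prod (mS n v₂))) +
      v₂ / n * (∫ s, (φ s) ^ 2 ∂((mS n v₁).prod (mS n v₂))) := by
  have hb' : ∀ x y : Fin n → ℝ, φ (sampleVar n x, sampleVar n y) ∈ Set.Icc (0 : ℝ) 1 :=
    fun x y => hb _ (sampleVar_nonneg n hn x) (sampleVar_nonneg n hn y)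
  have e : ∀ x : (Fin n → ℝ) × (Fin n → ℝ), (estimatorOf n φ x - 0) ^ 2 =
      (sampleMean n x.1 ^ 2 * (fun _ => (1 : ℝ)) (sampleMean n x.2) *
        (fun s => (1 - φ s) ^ 2) (sampleVar n x.1, sampleVar n x.2) +
      (fun _ => (1 : ℝ)) (sampleMean n x.1) * sampleMean n x.2 ^ 2 *
        (fun s => (φ s) ^ 2) (sampleVar n x.1, sampleVar n x.2)) +
      sampleMean n x.1 * sampleMean n x.2 *
        (fun s => 2 * (1 - φ s) * φ s) (sampleVar n x.1, sampleVar n x.2) := by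
    intro x
    simp only [estimatorOf]
    ring
  unfold risk
  simp_rw [e]
  have m1 : ∀ v, Integrable (fun x => sampleMean n x) (gpi n v) := fun v =>
    (mean_hasGaussianLaw n v).integrable
  have m2 : ∀ v, Integrable (fun x => sampleMean n x ^ 2) (gpi n v) := fun v =>
    (mean_hasGaussianLaw n v).memLp_two.integrable_sq
  have m0 : ∀ v, Integrable (fun x => (fun _ => (1 : ℝ)) (sampleMean n x)) (gpi n v) := fun v =>
    integrable_const _
  have b1 : ∀ x y : Fin n → ℝ, |(fun s => (1 - φ s) ^ 2) (sampleVar n x, sampleVar n y)| ≤ 2 := by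
    intro x y
    have := hb' x y
    rw [abs_le]; constructor <;> nlinarith [this.1, this.2]
  have b2 : ∀ x y : Fin n → ℝ, |(fun s => (φ s) ^ 2) (sampleVar n x, sampleVar n y)| ≤ 2 := by
    intro x y
    have := hb' x y
    rw [abs_le]; constructor <;> nlinarith [this.1, this.2]
  have b3 : ∀ x y : Fin n → ℝ,
      |(fun s => 2 * (1 - φ s) * φ s) (sampleVar n x, sampleVar n y)| ≤ 2 := by
    intro x y
    have := hb' x y
    rw [abs_le]; constructor <;> nlinarith [this.1, this.2]
  have k1 : Measurable (fun s => (1 - φ s) ^ 2) := by fun_prop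
  have k2 : Measurable (fun s => (φ s) ^ 2) := by fun_prop
  have k3 : Measurable (fun s => 2 * (1 - φ s) * φ s) := by fun_prop
  have i1 := integrable_fgpsi n v₁ v₂ (fun t => t ^ 2) (fun _ => 1) _ k1 2 b1 (m2 _) (m0 _)
  have i2 := integrable_fgpsi n v₁ v₂ (fun _ => 1) (fun t => t ^ 2) _ k2 2 b2 (m0 _) (m2 _)
  have i3 := integrable_fgpsi n v₁ v₂ (fun t => t) (fun t => t) _ k3 2 b3 (m1 _) (m1 _)
  have j1 := integral_fgpsi n hn v₁ v₂ (fun t => t ^ 2) (fun _ => 1) _ (by fun_prop) (by fun_prop)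
    k1 2 b1 (m2 _) (m0 _)
  have j2 := integral_fgpsi n hn v₁ v₂ (fun _ => 1) (fun t => t ^ 2) _ (by fun_prop) (by fun_prop)
    k2 2 b2 (m0 _) (m2 _)
  have j3 := integral_fgpsi n hn v₁ v₂ (fun t => t) (fun t => t) _ (by fun_prop) (by fun_prop)
    k3 2 b3 (m1 _) (m1 _)
  rw [integral_mean_sq n hn _ h₁] at j1
  rw [integral_mean_sq n hn _ h₂] at j2
  rw [integral_mean n] at j3
  have hs : sampleLaw n 0 v₁ v₂ = (gpi n v₁).prod (gpi n v₂) := rfl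
  have t := integral_add (i1.add i2) i3
  have t' := integral_add i1 i2
  simp only [Pi.add_apply] at t
  rw [hs, t, t', j1, j2, j3]
  simp

def SS (n : ℕ) (x : (Fin n → ℝ) × (Fin n → ℝ)) : ℝ × ℝ := (sampleVar n x.1, sampleVar n x.2)

lemma measurable_SS (n : ℕ) : Measurable (SS n) := by
  have hmv := measurable_sampleVar n
  unfold SS; fun_prop

lemma mS_prod_eq (n : ℕ) (v₁ v₂ : ℝ) :
    (mS n v₁).prod (mS n v₂) = ((gpi n v₁).prod (gpi n v₂)).map (SS n) := by
  have hmv := measurable_sampleVar n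
  rw [mS, mS, Measure.map_prod_map _ _ hmv hmv]
  rfl

lemma integral_mS_eq (n : ℕ) (v₁ v₂ : ℝ) (ψ : ℝ × ℝ → ℝ) (hψ : Measurable ψ) :
    ∫ s, ψ s ∂((mS n v₁).prod (mS n v₂)) = ∫ x, ψ (SS n x) ∂((gpi n v₁).prod (gpi n v₂)) := by
  rw [mS_prod_eq, integral_map (measurable_SS n).aemeasurable hψ.aestronglyMeasurable]

lemma integral_mS_cv (n : ℕ) (hn : 3 ≤ n) (v₁ v₂ : ℝ) (h₁ : 0 < v₁) (h₂ : 0 < v₂)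
    (ψ : ℝ × ℝ → ℝ) (hψ : Measurable ψ) :
    ∫ s, ψ s ∂((mS n v₁).prod (mS n v₂)) =
      ∫ x, kap n v₁ (SS n x).1 * kap n v₂ (SS n x).2 * ψ (SS n x) ∂((gpi n 1).prod (gpi n 1)) := by
  have k1 := measurable_kap n v₁
  have k2 := measurable_kap n v₂
  rw [← integral_mS_eq n 1 1 (fun s => kap n v₁ s.1 * kap n v₂ s.2 * ψ s) (by fun_prop),
    mS_eq n hn v₁ h₁, mS_eq n hn v₂ h₂,
    prod_withDensity k1.ennreal_ofReal k2.ennreal_ofReal,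
    integral_withDensity_eq_integral_toReal_smul (by fun_prop)
      (Filter.Eventually.of_forall fun s => ENNReal.mul_lt_top ENNReal.ofReal_lt_top
        ENNReal.ofReal_lt_top)]
  refine integral_congr_ae (Filter.Eventually.of_forall fun s => ?_)
  simp only [smul_eq_mul, ENNReal.toReal_mul, ENNReal.toReal_ofReal (kap_nonneg _ _ _)]

lemma integral_kk (n : ℕ) (hn : 3 ≤ n) (v₁ v₂ : ℝ) (h₁ : 0 < v₁) (h₂ : 0 < v₂) :
    ∫ x, kap n v₁ (SS n x).1 * kap n v₂ (SS n x).2 ∂((gpi n 1).prod (gpi n 1)) = 1 := by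
  have := integral_mS_cv n hn v₁ v₂ h₁ h₂ (fun _ => 1) measurable_const
  simp only [mul_one] at this
  rw [← this]
  simp

def GG (φ Φ : ℝ × ℝ → ℝ) (v s : ℝ × ℝ) : ℝ :=
  v.1 * ((1 - φ s) ^ 2 - (1 - Φ s) ^ 2) + v.2 * (φ s ^ 2 - Φ s ^ 2)

lemma diff_eq (n : ℕ) (hn : 3 ≤ n) (v : ℝ × ℝ) (h₁ : 0 < v.1) (h₂ : 0 < v.2) (φ Φ : ℝ × ℝ → ℝ)
    (hφ : Measurable φ) (hb : ∀ s : ℝ × ℝ, 0 ≤ s.1 → 0 ≤ s.2 → φ s ∈ Set.Icc (0 : ℝ) 1)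
    (hΦ : Measurable Φ) (hB : ∀ s : ℝ × ℝ, 0 ≤ s.1 → 0 ≤ s.2 → Φ s ∈ Set.Icc (0 : ℝ) 1) :
    risk n 0 v.1 v.2 φ - risk n 0 v.1 v.2 Φ =
      ∫ x, kap n v.1 (SS n x).1 * kap n v.2 (SS n x).2 * (GG φ Φ v (SS n x) / n)
        ∂((gpi n 1).prod (gpi n 1)) := by
  have hS := measurable_SS n
  have hG : Measurable (fun s => GG φ Φ v s / n) := by unfold GG; fun_prop
  rw [← integral_mS_cv n hn v.1 v.2 h₁ h₂ (fun s => GG φ Φ v s / n) hG,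
    risk_eq n hn v.1 v.2 h₁ h₂ φ hφ hb, risk_eq n hn v.1 v.2 h₁ h₂ Φ hΦ hB]
  simp only [integral_mS_eq n v.1 v.2 _ hG]
  have key : ∀ χ : ℝ × ℝ → ℝ, Measurable χ →
      (∀ s : ℝ × ℝ, 0 ≤ s.1 → 0 ≤ s.2 → χ s ∈ Set.Icc (0 : ℝ) 1) →
      Integrable (fun x => (1 - χ (SS n x)) ^ 2) ((gpi n v.1).prod (gpi n v.2)) ∧
      Integrable (fun x => (χ (SS n x)) ^ 2) ((gpi n v.1).prod (gpi n v.2)) ∧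
      ∫ s, (1 - χ s) ^ 2 ∂((mS n v.1).prod (mS n v.2)) =
        ∫ x, (1 - χ (SS n x)) ^ 2 ∂((gpi n v.1).prod (gpi n v.2)) ∧
      ∫ s, (χ s) ^ 2 ∂((mS n v.1).prod (mS n v.2)) =
        ∫ x, (χ (SS n x)) ^ 2 ∂((gpi n v.1).prod (gpi n v.2)) := by
    intro χ hχ hc
    have hc' : ∀ x, χ (SS n x) ∈ Set.Icc (0 : ℝ) 1 :=
      fun x => hc _ (sampleVar_nonneg n hn _) (sampleVar_nonneg n hn _)
    refine ⟨?_, ?_, integral_mS_eq n v.1 v.2 (fun s => (1 - χ s) ^ 2) (by fun_prop),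
      integral_mS_eq n v.1 v.2 (fun s => (χ s) ^ 2) (by fun_prop)⟩
    · refine Integrable.of_bound (C := 1)
        (by fun_prop : Measurable fun x => (1 - χ (SS n x)) ^ 2).aestronglyMeasurable (Filter.Eventually.of_forall fun x => ?_)
      have := hc' x
      rw [Real.norm_eq_abs, abs_le]; constructor <;> nlinarith [this.1, this.2]
    · refine Integrable.of_bound (C := 1)
        (by fun_prop : Measurable fun x => (χ (SS n x)) ^ 2).aestronglyMeasurable (Filter.Eventually.of_forall fun x => ?_)
      have := hc' x
      rw [Real.norm_eq_abs, abs_le]; constructor <;> nlinarith [this.1, this.2]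
  obtain ⟨a1, a2, a3, a4⟩ := key φ hφ hb
  obtain ⟨c1, c2, c3, c4⟩ := key Φ hΦ hB
  rw [a3, a4, c3, c4]
  have e : ∀ x, GG φ Φ v (SS n x) / n =
      (v.1 / n * (1 - φ (SS n x)) ^ 2 + v.2 / n * φ (SS n x) ^ 2) -
      (v.1 / n * (1 - Φ (SS n x)) ^ 2 + v.2 / n * Φ (SS n x) ^ 2) := by
    intro x; unfold GG; ring
  simp_rw [e]
  have t := integral_sub ((a1.const_mul (v.1 / n)).add (a2.const_mul (v.2 / n)))
    ((c1.const_mul (v.1 / n)).add (c2.const_mul (v.2 / n)))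
  simp only [Pi.add_apply] at t
  rw [t, integral_add (a1.const_mul _) (a2.const_mul _),
    integral_add (c1.const_mul _) (c2.const_mul _)]
  simp only [integral_const_mul]

lemma swap_measurePreserving (a : ℝ) (ha : 0 < a) :
    MeasurePreserving (fun v : ℝ × ℝ => (a * v.2, a⁻¹ * v.1)) volume volume := by
  refine ⟨by fun_prop, ?_⟩
  have h1 : (fun v : ℝ × ℝ => (a * v.2, a⁻¹ * v.1)) =
      (Prod.map (fun t => a * t) (fun t => a⁻¹ * t)) ∘ Prod.swap := by
    funext v; rfl
  rw [h1, ← Measure.map_map (by fun_prop) measurable_swap, Measure.volume_eq_prod,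
    Measure.prod_swap, ← Measure.map_prod_map _ _ (by fun_prop) (by fun_prop),
    Real.map_volume_mul_left ha.ne', Real.map_volume_mul_left (inv_pos.2 ha).ne',
    Measure.prod_smul_left, Measure.prod_smul_right, smul_smul, ← ENNReal.ofReal_mul (abs_nonneg _),
    ← abs_mul]
  rw [inv_inv, inv_mul_cancel₀ ha.ne']
  simp

lemma integral_nonneg_of_symm (F : ℝ × ℝ → ℝ) (σ : ℝ × ℝ → ℝ × ℝ)
    (hσ : MeasurePreserving σ volume volume) (h : ∀ v, 0 ≤ F v + F (σ v)) : 0 ≤ ∫ v, F v := by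
  by_cases hF : Integrable F
  · have h1 : Integrable (fun v => F (σ v)) := (hσ.integrable_comp hF.aestronglyMeasurable).2 hF
    have h2 : ∫ v, F (σ v) = ∫ v, F v := by
      have := integral_map (μ := (volume : Measure (ℝ × ℝ))) hσ.measurable.aemeasurable (f := F)
        (by rw [hσ.map_eq]; exact hF.aestronglyMeasurable)
      rw [hσ.map_eq] at this
      exact this.symm
    have h3 : 0 ≤ ∫ v, (F v + F (σ v)) := integral_nonneg (fun v => h v)
    rw [integral_add hF h1, h2] at h3
    linarith
  · rw [integral_undef hF]

lemma integrable_invpow (p β : ℝ) (hp : 0 < p) (hβ : 0 < β) :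
    Integrable (fun v : ℝ => if 0 < v then v ^ (-(p + 1)) * Real.exp (-β / v) else 0) := by
  have h0 : IntegrableOn (fun y : ℝ => y ^ (p - 1) * Real.exp (-β * y)) (Set.Ioi 0) := by
    have := integrableOn_rpow_mul_exp_neg_mul_rpow (p := 1) (s := p - 1) (b := β) (by linarith)
      one_pos hβ
    simpa using this
  have h1 := (integrableOn_Ioi_comp_rpow_iff' (fun y : ℝ => y ^ (p - 1) * Real.exp (-β * y))
    (p := -1) (by norm_num)).2 h0
  have h2 : IntegrableOn (fun v : ℝ => v ^ (-(p + 1)) * Real.exp (-β / v)) (Set.Ioi 0) := by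
    refine h1.congr_fun (fun v hv => ?_) measurableSet_Ioi
    have hv' : (0 : ℝ) < v := hv
    simp only [smul_eq_mul]
    rw [← Real.rpow_mul hv'.le, ← mul_assoc, ← Real.rpow_add hv', Real.rpow_neg_one]
    congr 2
    ring
  rw [← integrable_indicator_iff measurableSet_Ioi] at h2
  exact h2

lemma integrable_invGamma (α β : ℝ) (hα : 0 < α) (hβ : 0 < β) :
    Integrable (invGammaDensity α β) := by
  refine ((integrable_invpow α β hα hβ).const_mul (β ^ α / Real.Gamma α)).congr
    (Filter.Eventually.of_forall fun v => ?_)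
  simp only [invGammaDensity]
  split_ifs <;> ring

lemma integrable_invGamma_inv (α β : ℝ) (hα : 0 < α) (hβ : 0 < β) :
    Integrable (fun v => v⁻¹ * invGammaDensity α β v) := by
  refine ((integrable_invpow (α + 1) β (by linarith) hβ).const_mul (β ^ α / Real.Gamma α)).congr
    (Filter.Eventually.of_forall fun v => ?_)
  simp only [invGammaDensity]
  split_ifs with hv
  · rw [show -(α + 1 + 1) = -(α + 1) + -1 by ring, Real.rpow_add hv, Real.rpow_neg_one]
    ring
  · ring

lemma invGamma_nonneg (α β : ℝ) (hα : 0 < α) (hβ : 0 < β) (v : ℝ) : 0 ≤ invGammaDensity α β v := by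
  have := Real.Gamma_pos_of_pos hα
  unfold invGammaDensity
  split_ifs
  · positivity
  · exact le_rfl

lemma measurable_invGamma (α β : ℝ) : Measurable (invGammaDensity α β) := by
  unfold invGammaDensity
  refine Measurable.ite measurableSet_Ioi ?_ measurable_const
  fun_prop

def WW (n : ℕ) (α β : ℝ) (v s : ℝ × ℝ) : ℝ :=
  invGammaDensity α β v.1 * invGammaDensity α β v.2 * (kap n v.1 s.1 * kap n v.2 s.2)

lemma inv_kap (n : ℕ) (hn : 3 ≤ n) (α β v s : ℝ) (hv : 0 < v) :
    invGammaDensity α β v * kap n v s =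
      (β ^ α / Real.Gamma α * Real.exp (((n : ℝ) - 1) * s / 2)) *
      (v ^ (-(α + 1)) * (√v)⁻¹ ^ (n - 1)) *
      Real.exp (-(((n : ℝ) - 1) / 2 * ((s + 2 * β / (n - 1)) / v))) := by
  have hn' : (n : ℝ) - 1 ≠ 0 := by
    have : (3 : ℝ) ≤ n := by exact_mod_cast hn
    linarith
  have e : Real.exp (-β / v) * Real.exp (((n : ℝ) - 1) * s / 2 * (1 - 1 / v)) =
      Real.exp (((n : ℝ) - 1) * s / 2) *
      Real.exp (-(((n : ℝ) - 1) / 2 * ((s + 2 * β / (n - 1)) / v))) := by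
    rw [← Real.exp_add, ← Real.exp_add]
    congr 1
    field_simp
    ring
  unfold invGammaDensity kap
  rw [if_pos hv]
  linear_combination (β ^ α / Real.Gamma α * v ^ (-(α + 1)) * (√v)⁻¹ ^ (n - 1)) * e

lemma WW_symm (n : ℕ) (hn : 3 ≤ n) (α β : ℝ) (s : ℝ × ℝ)
    (h1 : 0 < s.1 + 2 * β / (n - 1)) (h2 : 0 < s.2 + 2 * β / (n - 1)) (a : ℝ)
    (ha : a = (s.1 + 2 * β / (n - 1)) / (s.2 + 2 * β / (n - 1))) (v : ℝ × ℝ) :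
    WW n α β (a * v.2, a⁻¹ * v.1) s = WW n α β v s := by
  have ha0 : 0 < a := by rw [ha]; positivity
  have ha1 : 0 < a⁻¹ := inv_pos.2 ha0
  by_cases p1 : 0 < v.1
  · by_cases p2 : 0 < v.2
    · have q1 := inv_kap n hn α β v.1 s.1 p1
      have q2 := inv_kap n hn α β v.2 s.2 p2
      have q3 := inv_kap n hn α β (a * v.2) s.1 (mul_pos ha0 p2)
      have q4 := inv_kap n hn α β (a⁻¹ * v.1) s.2 (mul_pos ha1 p1)
      have l : WW n α β v s = (invGammaDensity α β v.1 * kap n v.1 s.1) *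
          (invGammaDensity α β v.2 * kap n v.2 s.2) := by unfold WW; ring
      have r : WW n α β (a * v.2, a⁻¹ * v.1) s =
          (invGammaDensity α β (a * v.2) * kap n (a * v.2) s.1) *
          (invGammaDensity α β (a⁻¹ * v.1) * kap n (a⁻¹ * v.1) s.2) := by unfold WW; ring
      have e1 : (s.1 + 2 * β / (n - 1)) / (a * v.2) = (s.2 + 2 * β / (n - 1)) / v.2 := by
        have : s.1 + 2 * β / (n - 1) = a * (s.2 + 2 * β / (n - 1)) := by
          rw [ha, div_mul_cancel₀ _ h2.ne']
        rw [this, mul_div_mul_left _ _ ha0.ne']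
      have e2 : (s.2 + 2 * β / (n - 1)) / (a⁻¹ * v.1) = (s.1 + 2 * β / (n - 1)) / v.1 := by
        have : s.2 + 2 * β / (n - 1) = a⁻¹ * (s.1 + 2 * β / (n - 1)) := by
          rw [ha, inv_div, div_mul_cancel₀ _ h1.ne']
        rw [this, mul_div_mul_left _ _ ha1.ne']
      have e3 : (a * v.2) ^ (-(α + 1)) * (a⁻¹ * v.1) ^ (-(α + 1)) =
          v.1 ^ (-(α + 1)) * v.2 ^ (-(α + 1)) := by
        rw [← Real.mul_rpow (by positivity) (by positivity), ← Real.mul_rpow p1.le p2.le]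
        congr 1
        field_simp
      have e4 : (√(a * v.2))⁻¹ ^ (n - 1) * (√(a⁻¹ * v.1))⁻¹ ^ (n - 1) =
          (√v.1)⁻¹ ^ (n - 1) * (√v.2)⁻¹ ^ (n - 1) := by
        rw [← mul_pow, ← mul_pow, ← mul_inv, ← mul_inv, ← Real.sqrt_mul (by positivity),
          ← Real.sqrt_mul (by positivity)]
        congr 3
        field_simp
      rw [l, r, q1, q2, q3, q4, e1, e2]
      generalize Real.exp (-(((n : ℝ) - 1) / 2 * ((s.2 + 2 * β / (n - 1)) / v.2))) = E2
      generalize Real.exp (-(((n : ℝ) - 1) / 2 * ((s.1 + 2 * β / (n - 1)) / v.1))) = E1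
      generalize (β ^ α / Real.Gamma α * Real.exp (((n : ℝ) - 1) * s.1 / 2)) = C1
      generalize (β ^ α / Real.Gamma α * Real.exp (((n : ℝ) - 1) * s.2 / 2)) = C2
      calc _ = C1 * C2 * E1 * E2 * ((a * v.2) ^ (-(α + 1)) * (a⁻¹ * v.1) ^ (-(α + 1))) *
            ((√(a * v.2))⁻¹ ^ (n - 1) * (√(a⁻¹ * v.1))⁻¹ ^ (n - 1)) := by ring
        _ = _ := by rw [e3, e4]; ring
    · have : ¬ 0 < a * v.2 := fun h => p2 ((mul_pos_iff_of_pos_left ha0).1 h)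
      simp [WW, invGammaDensity, p2, this]
  · have : ¬ 0 < a⁻¹ * v.1 := fun h => p1 ((mul_pos_iff_of_pos_left ha1).1 h)
    simp only [WW, invGammaDensity, p1, this, if_false, mul_zero, zero_mul]

lemma WW_nonneg (n : ℕ) (α β : ℝ) (hα : 0 < α) (hβ : 0 < β) (v s : ℝ × ℝ) :
    0 ≤ WW n α β v s :=
  mul_nonneg (mul_nonneg (invGamma_nonneg α β hα hβ _) (invGamma_nonneg α β hα hβ _))
    (mul_nonneg (kap_nonneg _ _ _) (kap_nonneg _ _ _))

lemma WW_pos_of_ne (n : ℕ) (α β : ℝ) (v s : ℝ × ℝ) (h : WW n α β v s ≠ 0) :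
    0 < v.1 ∧ 0 < v.2 := by
  constructor
  · by_contra hc; exact h (by simp [WW, invGammaDensity, hc])
  · by_contra hc; exact h (by simp [WW, invGammaDensity, hc])

def FF (n : ℕ) (α β : ℝ) (φ Φ : ℝ × ℝ → ℝ) (N : ℝ) (v s : ℝ × ℝ) : ℝ :=
  if v.1 * v.2 ≤ N then WW n α β v s * (GG φ Φ v s / n) else 0

lemma n_sub_pos (n : ℕ) (hn : 3 ≤ n) : (0 : ℝ) < (n : ℝ) - 1 := by
  have : (3 : ℝ) ≤ n := by exact_mod_cast hn
  linarith

lemma bayesWeight_eq (n : ℕ) (β : ℝ) (s : ℝ × ℝ) :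
    bayesWeight n β s = (s.1 + 2 * β / (n - 1)) /
      ((s.1 + 2 * β / (n - 1)) + (s.2 + 2 * β / (n - 1))) := by
  unfold bayesWeight
  congr 1
  ring

lemma measurable_bayesWeight (n : ℕ) (β : ℝ) : Measurable (bayesWeight n β) := by
  unfold bayesWeight; fun_prop

lemma bayesWeight_mem (n : ℕ) (hn : 3 ≤ n) (β : ℝ) (hβ : 0 < β) (s : ℝ × ℝ)
    (h1 : 0 ≤ s.1) (h2 : 0 ≤ s.2) : bayesWeight n β s ∈ Set.Icc (0 : ℝ) 1 := by
  have := n_sub_pos n hn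
  have hb : 0 < 2 * β / ((n : ℝ) - 1) := by positivity
  rw [bayesWeight_eq]
  constructor
  · positivity
  · rw [div_le_one (by positivity)]; linarith

lemma FF_inner_nonneg (n : ℕ) (hn : 3 ≤ n) (α β : ℝ) (hα : 0 < α) (hβ : 0 < β)
    (φ : ℝ × ℝ → ℝ) (N : ℝ) (s : ℝ × ℝ) (hs1 : 0 ≤ s.1) (hs2 : 0 ≤ s.2) :
    0 ≤ ∫ v, FF n α β φ (bayesWeight n β) N v s := by
  have hnp := n_sub_pos n hn
  have hb : 0 < 2 * β / ((n : ℝ) - 1) := by positivity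
  have h1 : 0 < s.1 + 2 * β / ((n : ℝ) - 1) := by positivity
  have h2 : 0 < s.2 + 2 * β / ((n : ℝ) - 1) := by positivity
  obtain ⟨a, ha⟩ : ∃ a, a = (s.1 + 2 * β / ((n : ℝ) - 1)) / (s.2 + 2 * β / ((n : ℝ) - 1)) := ⟨_, rfl⟩
  have ha0 : 0 < a := by rw [ha]; positivity
  refine integral_nonneg_of_symm _ _ (swap_measurePreserving a ha0) (fun v => ?_)
  have hp : a * v.2 * (a⁻¹ * v.1) = v.1 * v.2 := by field_simp
  simp only [FF, WW_symm n hn α β s h1 h2 a ha v, hp]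
  split_ifs
  · rw [← mul_add]
    by_cases hW : WW n α β v s = 0
    · simp [hW]
    · obtain ⟨p1, p2⟩ := WW_pos_of_ne n α β v s hW
      refine mul_nonneg (WW_nonneg n α β hα hβ v s) ?_
      rw [← add_div]
      refine div_nonneg ?_ (Nat.cast_nonneg n)
      have hΦ := bayesWeight_eq n β s
      obtain ⟨A, hA⟩ : ∃ A, A = s.1 + 2 * β / ((n : ℝ) - 1) := ⟨_, rfl⟩
      obtain ⟨B, hB⟩ : ∃ B, B = s.2 + 2 * β / ((n : ℝ) - 1) := ⟨_, rfl⟩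
      rw [← hA] at h1
      rw [← hB] at h2
      rw [← hA, ← hB] at ha hΦ
      have f1 : bayesWeight n β s * a⁻¹ = 1 - bayesWeight n β s := by
        rw [hΦ, ha]; field_simp; ring
      have f2 : (1 - bayesWeight n β s) * a = bayesWeight n β s := by
        rw [hΦ, ha]; field_simp; ring
      have hf : GG φ (bayesWeight n β) v s + GG φ (bayesWeight n β) (a * v.2, a⁻¹ * v.1) s =
          (φ s - bayesWeight n β s) ^ 2 * (v.1 + v.2 + a * v.2 + a⁻¹ * v.1) := by
        unfold GG
        linear_combination 2 * (φ s - bayesWeight n β s) * v.1 * f1 -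
          2 * (φ s - bayesWeight n β s) * v.2 * f2
      rw [hf]
      positivity
  · simp

lemma measurable_FF (n : ℕ) (α β : ℝ) (φ Φ : ℝ × ℝ → ℝ) (hφ : Measurable φ) (hΦ : Measurable Φ)
    (N : ℝ) : Measurable (fun p : (ℝ × ℝ) × ((Fin n → ℝ) × (Fin n → ℝ)) =>
      FF n α β φ Φ N p.1 (SS n p.2)) := by
  have hS := measurable_SS n
  have hmv := measurable_sampleVar n
  have hi := measurable_invGamma α β
  unfold FF
  refine Measurable.ite (measurableSet_le (by fun_prop) measurable_const) ?_ measurable_const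
  unfold WW GG kap
  fun_prop

lemma abs_GG_le (φ Φ : ℝ × ℝ → ℝ) (v s : ℝ × ℝ) (h1 : 0 < v.1) (h2 : 0 < v.2)
    (hφ : φ s ∈ Set.Icc (0 : ℝ) 1) (hΦ : Φ s ∈ Set.Icc (0 : ℝ) 1) :
    |GG φ Φ v s| ≤ v.1 + v.2 := by
  obtain ⟨a, b⟩ := hφ
  obtain ⟨c, d⟩ := hΦ
  have A1 : |(1 - φ s) ^ 2 - (1 - Φ s) ^ 2| ≤ 1 := by
    rw [abs_le]; constructor <;> nlinarith
  have A2 : |φ s ^ 2 - Φ s ^ 2| ≤ 1 := by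
    rw [abs_le]; constructor <;> nlinarith
  unfold GG
  refine (abs_add_le _ _).trans ?_
  rw [abs_mul, abs_mul, abs_of_pos h1, abs_of_pos h2]
  nlinarith

lemma integrable_bound (n : ℕ) (hn : 3 ≤ n) (α β : ℝ) (hα : 0 < α) (hβ : 0 < β) (N : ℝ) :
    Integrable (fun p : (ℝ × ℝ) × ((Fin n → ℝ) × (Fin n → ℝ)) =>
      N * (p.1.1⁻¹ + p.1.2⁻¹) * WW n α β p.1 (SS n p.2))
      ((volume : Measure (ℝ × ℝ)).prod ((gpi n 1).prod (gpi n 1))) := by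
  have hS := measurable_SS n
  have hmv := measurable_sampleVar n
  have hi := measurable_invGamma α β
  have hm : Measurable (fun p : (ℝ × ℝ) × ((Fin n → ℝ) × (Fin n → ℝ)) =>
      N * (p.1.1⁻¹ + p.1.2⁻¹) * WW n α β p.1 (SS n p.2)) := by
    unfold WW kap
    fun_prop
  have hkk : ∀ v : ℝ × ℝ, 0 < v.1 → 0 < v.2 → Integrable (fun x => WW n α β v (SS n x))
      ((gpi n 1).prod (gpi n 1)) := by
    intro v p1 p2
    unfold WW
    refine Integrable.const_mul ?_ _
    by_contra hc
    have := integral_kk n hn v.1 v.2 p1 p2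
    rw [integral_undef hc] at this
    exact zero_ne_one this
  have hI : ∀ v : ℝ × ℝ, ∫ x, WW n α β v (SS n x) ∂((gpi n 1).prod (gpi n 1)) =
      invGammaDensity α β v.1 * invGammaDensity α β v.2 := by
    intro v
    unfold WW
    rw [integral_const_mul]
    by_cases p1 : 0 < v.1
    · by_cases p2 : 0 < v.2
      · rw [integral_kk n hn v.1 v.2 p1 p2, mul_one]
      · simp [invGammaDensity, p2]
    · simp [invGammaDensity, p1]
  rw [integrable_prod_iff hm.aestronglyMeasurable]
  constructor
  · refine Filter.Eventually.of_forall fun v => ?_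
    by_cases p : 0 < v.1 ∧ 0 < v.2
    · exact (hkk v p.1 p.2).const_mul (N * (v.1⁻¹ + v.2⁻¹))
    · have : ∀ x, WW n α β v (SS n x) = 0 := fun x => by
        by_contra hc
        exact p (WW_pos_of_ne n α β v _ hc)
      simp [this]
  · have e : ∀ v : ℝ × ℝ, ∫ x, ‖N * (v.1⁻¹ + v.2⁻¹) * WW n α β v (SS n x)‖
        ∂((gpi n 1).prod (gpi n 1)) =
        ‖N * (v.1⁻¹ * invGammaDensity α β v.1 * invGammaDensity α β v.2 +
          invGammaDensity α β v.1 * (v.2⁻¹ * invGammaDensity α β v.2))‖ := by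
      intro v
      have : ∀ x, ‖N * (v.1⁻¹ + v.2⁻¹) * WW n α β v (SS n x)‖ =
          |N * (v.1⁻¹ + v.2⁻¹)| * WW n α β v (SS n x) := fun x => by
        rw [Real.norm_eq_abs, abs_mul, abs_of_nonneg (WW_nonneg n α β hα hβ _ _)]
      simp_rw [this]
      rw [integral_const_mul, hI, ← abs_of_nonneg (mul_nonneg (invGamma_nonneg α β hα hβ v.1)
        (invGamma_nonneg α β hα hβ v.2)), ← abs_mul, Real.norm_eq_abs]
      congr 1
      ring
    simp only [e]
    refine Integrable.norm ?_
    refine Integrable.const_mul ?_ _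
    rw [Measure.volume_eq_prod]
    exact ((integrable_invGamma_inv α β hα hβ).mul_prod (integrable_invGamma α β hα hβ)).add
      ((integrable_invGamma α β hα hβ).mul_prod (integrable_invGamma_inv α β hα hβ))

lemma integrable_FF (n : ℕ) (hn : 3 ≤ n) (α β : ℝ) (hα : 0 < α) (hβ : 0 < β)
    (φ Φ : ℝ × ℝ → ℝ) (hφ : Measurable φ) (hΦ : Measurable Φ)
    (hb : ∀ s : ℝ × ℝ, 0 ≤ s.1 → 0 ≤ s.2 → φ s ∈ Set.Icc (0 : ℝ) 1)
    (hB : ∀ s : ℝ × ℝ, 0 ≤ s.1 → 0 ≤ s.2 → Φ s ∈ Set.Icc (0 : ℝ) 1) (N : ℝ) :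
    Integrable (fun p : (ℝ × ℝ) × ((Fin n → ℝ) × (Fin n → ℝ)) => FF n α β φ Φ N p.1 (SS n p.2))
      ((volume : Measure (ℝ × ℝ)).prod ((gpi n 1).prod (gpi n 1))) := by
  refine (integrable_bound n hn α β hα hβ N).mono
    (measurable_FF n α β φ Φ hφ hΦ N).aestronglyMeasurable (Filter.Eventually.of_forall ?_)
  rintro ⟨v, x⟩
  simp only [FF]
  split_ifs with hN
  · by_cases hW : WW n α β v (SS n x) = 0
    · simp [hW]
    · obtain ⟨p1, p2⟩ := WW_pos_of_ne n α β v _ hW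
      have hg := abs_GG_le φ Φ v (SS n x) p1 p2
        (hb _ (sampleVar_nonneg n hn _) (sampleVar_nonneg n hn _))
        (hB _ (sampleVar_nonneg n hn _) (sampleVar_nonneg n hn _))
      rw [norm_mul, norm_mul, mul_comm]
      refine mul_le_mul_of_nonneg_right ?_ (norm_nonneg _)
      have hn1 : (1 : ℝ) ≤ n := by exact_mod_cast (by omega : 1 ≤ n)
      rw [Real.norm_eq_abs, Real.norm_eq_abs, abs_div, Nat.abs_cast]
      refine (div_le_self (abs_nonneg _) hn1).trans (hg.trans (le_trans ?_ (le_abs_self _)))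
      have : v.1 + v.2 = (v.1 * v.2) * (v.1⁻¹ + v.2⁻¹) := by field_simp; ring
      rw [this]
      exact mul_le_mul_of_nonneg_right hN (by positivity)
  · rw [norm_zero]; exact norm_nonneg _

lemma setIntegral_nonneg_N (n : ℕ) (hn : 3 ≤ n) (α : ℝ) (hα : 0 < α) (β : ℝ) (hβ : 0 < β)
    (φ : ℝ × ℝ → ℝ) (hφmeas : Measurable φ) (hφ : ∀ s, φ s ∈ Set.Icc (0 : ℝ) 1) (N : ℝ) :
    0 ≤ ∫ v in {v : ℝ × ℝ | v.1 * v.2 ≤ N},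
        (risk n 0 v.1 v.2 φ - risk n 0 v.1 v.2 (bayesWeight n β)) ∂(invGammaPrior α β) := by
  have hi := measurable_invGamma α β
  have hR : MeasurableSet {v : ℝ × ℝ | v.1 * v.2 ≤ N} :=
    measurableSet_le (by fun_prop) measurable_const
  have e : ∫ v in {v : ℝ × ℝ | v.1 * v.2 ≤ N},
        (risk n 0 v.1 v.2 φ - risk n 0 v.1 v.2 (bayesWeight n β)) ∂(invGammaPrior α β) =
      ∫ v, ∫ x, FF n α β φ (bayesWeight n β) N v (SS n x) ∂((gpi n 1).prod (gpi n 1)) := by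
    rw [← integral_indicator hR, invGammaPrior,
      integral_withDensity_eq_integral_toReal_smul (by fun_prop)
      (Filter.Eventually.of_forall fun s => ENNReal.ofReal_lt_top)]
    refine integral_congr_ae (Filter.Eventually.of_forall fun v => ?_)
    simp only [smul_eq_mul, ENNReal.toReal_ofReal (mul_nonneg (invGamma_nonneg α β hα hβ v.1)
        (invGamma_nonneg α β hα hβ v.2)), Set.indicator_apply, Set.mem_ofPred_eq, FF]
    split_ifs with hN
    · by_cases p : 0 < v.1 ∧ 0 < v.2
      · rw [diff_eq n hn v p.1 p.2 φ (bayesWeight n β) hφmeas (fun s _ _ => hφ s)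
          (measurable_bayesWeight n β) (bayesWeight_mem n hn β hβ), ← integral_const_mul]
        refine integral_congr_ae (Filter.Eventually.of_forall fun x => ?_)
        simp only [WW]
        ring
      · have h0 : ∀ x, WW n α β v (SS n x) = 0 := fun x => by
          by_contra hc
          exact p (WW_pos_of_ne n α β v _ hc)
        have h1 : invGammaDensity α β v.1 * invGammaDensity α β v.2 = 0 := by
          by_cases p1 : 0 < v.1
          · have p2 : ¬ 0 < v.2 := fun h => p ⟨p1, h⟩
            simp [invGammaDensity, p2]
          · simp [invGammaDensity, p1]
        simp [h0, h1]
    · simp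
  rw [e, integral_integral_swap (integrable_FF n hn α β hα hβ φ (bayesWeight n β) hφmeas
    (measurable_bayesWeight n β) (fun s _ _ => hφ s) (bayesWeight_mem n hn β hβ) N)]
  exact integral_nonneg fun x => FF_inner_nonneg n hn α β hα hβ φ N (SS n x)
    (sampleVar_nonneg n hn _) (sampleVar_nonneg n hn _)

end

/-- The procedure determined by `Φ_β` has minimal Bayes risk under the product
inverse-gamma prior `Π_{α,β}` among the class `𝓒₁`. -/
theorem bayesWeight_minimal_bayes_risk (n : ℕ) (hn : 3 ≤ n)
    (α : ℝ) (hα : 0 < α) (hα' : α < 1 / 2) (β : ℝ) (hβ : 0 < β)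
    (φ : ℝ × ℝ → ℝ) (hφmeas : Measurable φ) (hφ : ∀ s, φ s ∈ Set.Icc (0 : ℝ) 1)
    (hint : Integrable
      (fun v : ℝ × ℝ => risk n 0 v.1 v.2 φ - risk n 0 v.1 v.2 (bayesWeight n β))
      (invGammaPrior α β)) :
    0 ≤ ∫ v : ℝ × ℝ,
        (risk n 0 v.1 v.2 φ - risk n 0 v.1 v.2 (bayesWeight n β))
      ∂(invGammaPrior α β) := by
  have hR : ∀ k : ℕ, MeasurableSet {v : ℝ × ℝ | v.1 * v.2 ≤ (k : ℝ)} := fun k =>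
    measurableSet_le (by fun_prop) measurable_const
  have hmono : Monotone (fun k : ℕ => {v : ℝ × ℝ | v.1 * v.2 ≤ (k : ℝ)}) := by
    intro k l hkl v hv
    exact le_trans (show v.1 * v.2 ≤ (k : ℝ) from hv) (by exact_mod_cast hkl)
  have hU : (⋃ k : ℕ, {v : ℝ × ℝ | v.1 * v.2 ≤ (k : ℝ)}) = Set.univ := by
    ext v
    simp only [Set.mem_iUnion, Set.mem_ofPred_eq, Set.mem_univ, iff_true]
    exact exists_nat_ge _
  have ht := tendsto_setIntegral_of_monotone hR hmono hint.integrableOn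
  rw [hU, setIntegral_univ] at ht
  exact ge_of_tendsto' ht fun k => setIntegral_nonneg_N n hn α hα β hβ φ hφmeas hφ k
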